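/- Let T be an exact measure preserving transformation of (X,𝓕,μ) and let f ∈ L_{2,π}^{sym}(μ²) be a canonical kernel of degree 2 such that the limit g = lim_{n_1,n_2→∞} Σ_{0 ≤ i_1 ≤ n_1−1, 0 ≤ i_2 ≤ n_2−1} V^{*(i_1,i_2)} f exists in L_{2,π}(μ²). Then f admits a unique representation f = g^∅ + (V^{(1,0)} − I) g^{{1}} + (V^{(0,1)} − I) g^{{2}} + (V^{(1,0)} − I)(V^{(0,1)} − I) g^{{1,2}}, where E(g^∅ | T^{−(1,0)}𝓕^{⊗2}) = 0, E(g^∅ | T^{−(0,1)}𝓕^{⊗2}) = 0, E(g^{{1}} | T^{−(0,1)}𝓕^{⊗2}) = 0, E(g^{{2}} | T^{−(1,0)}𝓕^{⊗2}) = 0, and g^∅, g^{{1}}, g^{{2}}, g^{{1,2}} are canonical. These four functions are uniquely determined by these properties; moreover g^∅, g^{{1,2}} ∈ L_{2,π}^{sym}(μ²), g^{{1}}, g^{{2}} ∈ L_{2,π}(μ²), and g^{{1}}∘θ = g^{{2}}, g^{{2}}∘θ = g^{{1}}. -/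

import Mathlib

open MeasureTheory Filter Topology ENNReal ProbabilityTheory

noncomputable section

namespace VonMises

variable {X : Type} [MeasurableSpace X]

/-- The `d`-fold product measure `μ^d` on the power space `X^d`. -/
abbrev pm (μ : Measure X) (d : ℕ) : Measure (Fin d → X) := Measure.pi fun _ => μ

/-- `(E, tp)` is (a realization of) the projective tensor product
`L_{p 0}(μ) ⊗̂_π ⋯ ⊗̂_π L_{p (d-1)}(μ)`: `tp` is a continuous multilinear map
satisfying the cross-norm identity, whose range spans a dense subspace, and which has
the (isometric) universal lifting property of the projective tensor norm. -/
structure IsPTP (μ : Measure X) {d : ℕ} (p : Fin d → ℝ≥0∞) [∀ i, Fact (1 ≤ p i)]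
    (E : Type) [NormedAddCommGroup E] [NormedSpace ℝ E] [CompleteSpace E]
    (tp : ContinuousMultilinearMap ℝ (fun i : Fin d => Lp ℝ (p i) μ) E) : Prop where
  crossNorm : ∀ f : ∀ i : Fin d, Lp ℝ (p i) μ, ‖tp f‖ = ∏ i, ‖f i‖
  denseSpan : Dense (Submodule.span ℝ (Set.range fun f : ∀ i : Fin d, Lp ℝ (p i) μ => tp f) : Set E)
  lift : ∀ (F : Type) [NormedAddCommGroup F] [NormedSpace ℝ F] [CompleteSpace F]
      (g : ContinuousMultilinearMap ℝ (fun i : Fin d => Lp ℝ (p i) μ) F),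
      ∃ L : E →L[ℝ] F, (∀ f, L (tp f) = g f) ∧ ‖L‖ = ‖g‖

/-- `J` realizes the canonical map from the projective tensor product into `L_q(μ^d)`,
determined by its values on elementary tensors. -/
def IsEmbed (μ : Measure X) {d : ℕ} (p : Fin d → ℝ≥0∞) [∀ i, Fact (1 ≤ p i)]
    (q : ℝ≥0∞) [Fact (1 ≤ q)]
    {E : Type} [NormedAddCommGroup E] [NormedSpace ℝ E] [CompleteSpace E]
    (tp : ContinuousMultilinearMap ℝ (fun i : Fin d => Lp ℝ (p i) μ) E)
    (J : E →L[ℝ] Lp ℝ q (pm μ d)) : Prop :=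
  ∀ f, (J (tp f) : (Fin d → X) → ℝ) =ᵐ[pm μ d] fun x => ∏ i, (f i : X → ℝ) (x i)

/-- `D` realizes the diagonal restriction operator: the norm-one linear map sending an
elementary tensor `f_1 ⊗ ⋯ ⊗ f_d` to the pointwise product `x ↦ f_1(x)⋯f_d(x)`. -/
def IsDiag (μ : Measure X) {d : ℕ} (p : Fin d → ℝ≥0∞) [∀ i, Fact (1 ≤ p i)]
    (r : ℝ≥0∞) [Fact (1 ≤ r)]
    {E : Type} [NormedAddCommGroup E] [NormedSpace ℝ E] [CompleteSpace E]
    (tp : ContinuousMultilinearMap ℝ (fun i : Fin d => Lp ℝ (p i) μ) E)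
    (D : E →L[ℝ] Lp ℝ r μ) : Prop :=
  ‖D‖ = 1 ∧ ∀ f, (D (tp f) : X → ℝ) =ᵐ[μ] fun x => ∏ i, (f i : X → ℝ) x

/-- `W` realizes the tensor Koopman operator `V^𝐤 = V_1^{k_1} ⊗_π ⋯ ⊗_π V_d^{k_d}`,
where `V_i g = g ∘ T_i`. -/
def IsTKoop (μ : Measure X) {d : ℕ} (p : Fin d → ℝ≥0∞) [∀ i, Fact (1 ≤ p i)]
    {E : Type} [NormedAddCommGroup E] [NormedSpace ℝ E] [CompleteSpace E]
    (tp : ContinuousMultilinearMap ℝ (fun i : Fin d => Lp ℝ (p i) μ) E)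
    (T : Fin d → X → X) (k : Fin d → ℕ) (W : E →L[ℝ] E) : Prop :=
  ∀ f g : ∀ i : Fin d, Lp ℝ (p i) μ,
    (∀ i, (g i : X → ℝ) =ᵐ[μ] fun x => (f i : X → ℝ) ((T i)^[k i] x)) → W (tp f) = tp g

/-- `g = V^{*k} f`: the adjoint (transfer) operator applied to `f`, characterized by
`∫_s g dμ = ∫_{T^{-k} s} f dμ` for all measurable `s`. -/
def IsTransfer (μ : Measure X) (T : X → X) (k : ℕ) {p : ℝ≥0∞} [Fact (1 ≤ p)]
    (f g : Lp ℝ p μ) : Prop :=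
  ∀ s : Set X, MeasurableSet s → ∫ x in s, g x ∂μ = ∫ x in T^[k] ⁻¹' s, f x ∂μ

/-- `W` realizes the tensor transfer operator `V^{*𝐤} = V_1^{*k_1} ⊗_π ⋯ ⊗_π V_d^{*k_d}`. -/
def IsTTrans (μ : Measure X) {d : ℕ} (p : Fin d → ℝ≥0∞) [∀ i, Fact (1 ≤ p i)]
    {E : Type} [NormedAddCommGroup E] [NormedSpace ℝ E] [CompleteSpace E]
    (tp : ContinuousMultilinearMap ℝ (fun i : Fin d => Lp ℝ (p i) μ) E)
    (T : Fin d → X → X) (k : Fin d → ℕ) (W : E →L[ℝ] E) : Prop :=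
  ∀ f g : ∀ i : Fin d, Lp ℝ (p i) μ,
    (∀ i, IsTransfer μ (T i) (k i) (f i) (g i)) → W (tp f) = tp g

/-- The σ-algebra of `T`-invariant measurable sets. -/
def invariants (T : X → X) : MeasurableSpace X where
  MeasurableSet' s := MeasurableSet s ∧ T ⁻¹' s = s
  measurableSet_empty := ⟨MeasurableSet.empty, rfl⟩
  measurableSet_compl s hs := ⟨hs.1.compl, by rw [Set.preimage_compl, hs.2]⟩
  measurableSet_iUnion s hs :=
    ⟨MeasurableSet.iUnion fun i => (hs i).1, by
      simp only [Set.preimage_iUnion]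
      exact Set.iUnion_congr fun i => (hs i).2⟩

/-- `W` realizes `E_{inv,1} ⊗_π ⋯ ⊗_π E_{inv,d}`, the projective tensor product of the
conditional expectations with respect to the invariant σ-fields. -/
def IsTCondexpInv (μ : Measure X) {d : ℕ} (p : Fin d → ℝ≥0∞) [∀ i, Fact (1 ≤ p i)]
    {E : Type} [NormedAddCommGroup E] [NormedSpace ℝ E] [CompleteSpace E]
    (tp : ContinuousMultilinearMap ℝ (fun i : Fin d => Lp ℝ (p i) μ) E)
    (T : Fin d → X → X) (W : E →L[ℝ] E) : Prop :=
  ∀ f g : ∀ i : Fin d, Lp ℝ (p i) μ,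
    (∀ i, (g i : X → ℝ) =ᵐ[μ] μ[(f i : X → ℝ) | invariants (T i)]) → W (tp f) = tp g

/-- Exactness of a measure preserving transformation: the tail σ-field
`⋂_n T^{-n}𝓕` is trivial mod `μ`. -/
def Exact (μ : Measure X) (T : X → X) : Prop :=
  ∀ s : Set X, (∀ n : ℕ, ∃ t : Set X, MeasurableSet t ∧ s = T^[n] ⁻¹' t) →
    μ s = 0 ∨ μ s = 1

/-- A kernel of `m` variables is canonical (totally degenerate) if integrating out any
one variable gives `0` almost everywhere. -/
def Canonical (μ : Measure X) (m : ℕ) (h : (Fin m → X) → ℝ) : Prop :=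
  ∀ l : Fin m, ∀ᵐ x ∂ pm μ m, ∫ y, h (Function.update x l y) ∂μ = 0

/-- A kernel of `d` variables is symmetric if it is a.e. invariant under permutations of
its variables. -/
def Symm (μ : Measure X) (d : ℕ) (h : (Fin d → X) → ℝ) : Prop :=
  ∀ σ : Equiv.Perm (Fin d), ∀ᵐ x ∂ pm μ d, h (x ∘ σ) = h x

end VonMises

namespace VonMises

set_option linter.unusedSectionVars false

section Aux

variable {X : Type} [MeasurableSpace X]

lemma aux_isClosed_tendsto {F G : Type*} [NormedAddCommGroup F] [NormedSpace ℝ F]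
    [NormedAddCommGroup G] [NormedSpace ℝ G] {ι : Type*} (l : Filter ι)
    (A : ι → F →L[ℝ] G) (A0 : F →L[ℝ] G) (hA : ∀ i, ‖A i‖ ≤ 1) :
    IsClosed {x | Tendsto (fun i => A i x) l (𝓝 (A0 x))} := by
  refine Equicontinuous.isClosed_setOfPred_tendsto (F := fun i x => A i x) ?_ A0.continuous
  refine (LipschitzWith.uniformEquicontinuous (fun i x => A i x) 1 fun i => ?_).equicontinuous
  exact (A i).lipschitz.weaken (by exact_mod_cast hA i)

/-- Koopman operator on `L²`. -/
def koop {μ : Measure X} {T : X → X} (hT : MeasurePreserving T μ μ) :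
    Lp ℝ 2 μ →L[ℝ] Lp ℝ 2 μ :=
  (Lp.compMeasurePreservingₗᵢ ℝ T hT).toContinuousLinearMap

/-- Transfer operator on `L²`. -/
def trans {μ : Measure X} {T : X → X} (hT : MeasurePreserving T μ μ) :
    Lp ℝ 2 μ →L[ℝ] Lp ℝ 2 μ :=
  ContinuousLinearMap.adjoint (koop hT)

/-- The constant function one. -/
def oneL (μ : Measure X) [IsProbabilityMeasure μ] : Lp ℝ 2 μ :=
  indicatorConstLp 2 MeasurableSet.univ (measure_ne_top μ _) (1 : ℝ)

/-- Integration operator on `L²`. -/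
def meanL (μ : Measure X) [IsProbabilityMeasure μ] : Lp ℝ 2 μ →L[ℝ] Lp ℝ 2 μ :=
  (innerSL ℝ (oneL μ)).smulRight (oneL μ)

variable {μ : Measure X} [IsProbabilityMeasure μ] {T : X → X}

lemma koop_coe (hT : MeasurePreserving T μ μ) (x : Lp ℝ 2 μ) :
    (koop hT x : X → ℝ) =ᵐ[μ] fun y => (x : X → ℝ) (T y) :=
  Lp.coeFn_compMeasurePreserving x hT

lemma koop_norm (hT : MeasurePreserving T μ μ) (x : Lp ℝ 2 μ) : ‖koop hT x‖ = ‖x‖ :=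
  (Lp.compMeasurePreservingₗᵢ ℝ T hT).norm_map x

lemma koop_opNorm (hT : MeasurePreserving T μ μ) : ‖koop hT‖ ≤ 1 :=
  ContinuousLinearMap.opNorm_le_bound _ zero_le_one fun x => by simp [koop_norm]

lemma trans_opNorm (hT : MeasurePreserving T μ μ) : ‖trans hT‖ ≤ 1 := by
  rw [trans, LinearIsometryEquiv.norm_map]; exact koop_opNorm hT

lemma trans_pow_opNorm (hT : MeasurePreserving T μ μ) (n : ℕ) : ‖trans hT ^ n‖ ≤ 1 := by
  induction n with
  | zero => exact ContinuousLinearMap.norm_id_le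
  | succ n ih =>
    rw [pow_succ]
    exact (norm_mul_le _ _).trans (mul_le_one₀ ih (norm_nonneg _) (trans_opNorm hT))

lemma trans_koop (hT : MeasurePreserving T μ μ) : trans hT * koop hT = 1 := by
  ext1 x
  refine ext_inner_left ℝ fun y => ?_
  simp only [trans, mul_apply_eq_comp, ContinuousLinearMap.adjoint_inner_right]
  exact (Lp.compMeasurePreservingₗᵢ ℝ T hT).inner_map_map y x

lemma trans_pow_koop_pow (hT : MeasurePreserving T μ μ) (n : ℕ) :
    trans hT ^ n * koop hT ^ n = 1 := by
  induction n with
  | zero => simp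
  | succ n ih =>
    rw [pow_succ, pow_succ', mul_assoc, ← mul_assoc (trans hT) (koop hT), trans_koop, one_mul, ih]

lemma oneL_coe : (oneL μ : X → ℝ) =ᵐ[μ] fun _ => 1 := by
  filter_upwards [indicatorConstLp_coeFn (p := 2) (hs := MeasurableSet.univ)
    (hμs := measure_ne_top μ _) (c := (1:ℝ))] with x hx
  rw [oneL, hx]; simp

lemma inner_oneL (x : Lp ℝ 2 μ) : inner ℝ (oneL μ) x = ∫ y, x y ∂μ := by
  rw [oneL, L2.inner_indicatorConstLp_one]; simp

lemma koop_oneL (hT : MeasurePreserving T μ μ) : koop hT (oneL μ) = oneL μ :=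
  Lp.indicatorConstLp_compMeasurePreserving MeasurableSet.univ _ _ hT

lemma trans_oneL (hT : MeasurePreserving T μ μ) : trans hT (oneL μ) = oneL μ := by
  conv_lhs => rw [← koop_oneL hT]
  exact DFunLike.congr_fun (trans_koop hT) (oneL μ)

lemma meanL_apply (x : Lp ℝ 2 μ) : meanL μ x = (∫ y, x y ∂μ) • oneL μ := by
  simp only [meanL, ContinuousLinearMap.smulRight_apply, innerSL_apply_apply, inner_oneL]

lemma meanL_apply' (x : Lp ℝ 2 μ) : meanL μ x = (inner ℝ (oneL μ) x) • oneL μ := by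
  simp only [meanL, ContinuousLinearMap.smulRight_apply, innerSL_apply_apply]

lemma trans_meanL (hT : MeasurePreserving T μ μ) : trans hT * meanL μ = meanL μ := by
  ext1 x; simp only [mul_apply_eq_comp, meanL_apply, map_smul, trans_oneL]

lemma koop_meanL (hT : MeasurePreserving T μ μ) : koop hT * meanL μ = meanL μ := by
  ext1 x; simp only [mul_apply_eq_comp, meanL_apply, map_smul, koop_oneL]

lemma meanL_trans (hT : MeasurePreserving T μ μ) : meanL μ * trans hT = meanL μ := by
  ext1 x
  simp only [mul_apply_eq_comp, meanL_apply', trans,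
    ContinuousLinearMap.adjoint_inner_right, koop_oneL]

lemma meanL_koop (hT : MeasurePreserving T μ μ) : meanL μ * koop hT = meanL μ := by
  rw [← meanL_trans hT, mul_assoc, trans_koop, mul_one, meanL_trans]

lemma trans_isTransfer (hT : MeasurePreserving T μ μ) (n : ℕ) (x : Lp ℝ 2 μ) :
    IsTransfer μ T n x ((trans hT ^ n) x) := by
  induction n with
  | zero => intro s hs; simp
  | succ n ih =>
    intro s hs
    have h1 := ih (T ⁻¹' s) (hT.measurable hs)
    rw [Function.iterate_succ', Set.preimage_comp, ← h1, pow_succ']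
    simp only [mul_apply_eq_comp]
    rw [← L2.inner_indicatorConstLp_one (𝕜 := ℝ) hs (measure_ne_top μ _),
      ← L2.inner_indicatorConstLp_one (𝕜 := ℝ) (hT.measurable hs) (measure_ne_top μ _),
      trans, ContinuousLinearMap.adjoint_inner_right]
    congr 1

lemma koop_pow_coe (hT : MeasurePreserving T μ μ) (n : ℕ) (x : Lp ℝ 2 μ) :
    ((koop hT ^ n) x : X → ℝ) =ᵐ[μ] fun y => (x : X → ℝ) (T^[n] y) := by
  induction n with
  | zero => simp
  | succ n ih =>
    rw [pow_succ']
    simp only [mul_apply_eq_comp]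
    refine (koop_coe hT _).trans ?_
    exact hT.quasiMeasurePreserving.ae_eq_comp ih

lemma exact_const (hT : MeasurePreserving T μ μ) (hex : Exact μ T) (x : Lp ℝ 2 μ)
    (y : ℕ → Lp ℝ 2 μ) (h : ∀ n, x = (koop hT ^ n) (y n)) : ∃ c : ℝ, x = c • oneL μ := by
  have hall : ∀ᵐ z ∂μ, ∀ n, (x : X → ℝ) z = (y n : X → ℝ) (T^[n] z) := by
    rw [ae_all_iff]; intro n
    have := koop_pow_coe hT n (y n)
    rwa [← h n] at this
  obtain ⟨c, hc⟩ := exists_eventuallyEq_const_of_forall_separating (l := ae μ)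
    (f := (x : X → ℝ)) MeasurableSet (fun U hU => by
      let S : ℕ → Set X := fun m => {z | ∃ᶠ n in atTop, (y (n + m) : X → ℝ) (T^[n] z) ∈ U}
      have hSm : ∀ m, MeasurableSet (S m) := fun m => by
        have : S m = ⋂ N : ℕ, ⋃ n ∈ Set.Ici N,
            (fun z => (y (n + m) : X → ℝ) (T^[n] z)) ⁻¹' U := by
          ext z; simp [S, Filter.frequently_atTop]
        rw [this]
        refine MeasurableSet.iInter fun N => MeasurableSet.biUnion (Set.to_countable _) fun n _ => ?_
        exact ((Lp.stronglyMeasurable (y (n + m))).measurable.comp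
          (hT.iterate n).measurable) hU
      have hS : ∀ m, S 0 = T^[m] ⁻¹' (S m) := fun m => by
        ext z
        simp only [S, Set.mem_preimage, Set.mem_ofPred_eq, ← Function.iterate_add_apply]
        have hh := frequently_map (m := fun n : ℕ => n + m) (f := atTop)
          (P := fun n => (y (n + 0) : X → ℝ) (T^[n] z) ∈ U)
        rw [map_add_atTop_eq_nat] at hh
        exact hh
      have hxS : ∀ᵐ z ∂μ, z ∈ S 0 ↔ (x : X → ℝ) z ∈ U := by
        filter_upwards [hall] with z hz
        simp [S, ← hz]
      rcases hex (S 0) (fun n => ⟨S n, hSm n, hS n⟩) with h0 | h1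
      · right
        have : ∀ᵐ z ∂μ, z ∉ S 0 := measure_eq_zero_iff_ae_notMem.1 h0
        filter_upwards [this, hxS] with z h1 h2
        rwa [← h2]
      · left
        have : ∀ᵐ z ∂μ, z ∈ S 0 := by
          rw [← prob_compl_eq_zero_iff (hSm 0)] at h1
          exact h1
        filter_upwards [this, hxS] with z h1 h2
        rwa [← h2])
  refine ⟨c, Lp.ext ?_⟩
  filter_upwards [hc, oneL_coe (μ := μ), Lp.coeFn_smul c (oneL μ)] with z h1 h2 h3
  rw [h1, h3]; simp [h2]

lemma trans_tendsto (hT : MeasurePreserving T μ μ) (hex : Exact μ T) (x : Lp ℝ 2 μ) :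
    Tendsto (fun n => (trans hT ^ n) x) atTop (𝓝 (meanL μ x)) := by
  have hfix : ∀ n, (trans hT ^ n) (meanL μ x) = meanL μ x := fun n => by
    induction n with
    | zero => simp
    | succ n ih =>
      rw [pow_succ]
      simp only [mul_apply_eq_comp]
      rw [show trans hT (meanL μ x) = meanL μ x from DFunLike.congr_fun (trans_meanL hT) x, ih]
  let K : Submodule ℝ (Lp ℝ 2 μ) := ⨆ n, (trans hT ^ n).ker
  have hcl : ∀ z ∈ K.topologicalClosure, Tendsto (fun n => (trans hT ^ n) z) atTop (𝓝 0) := by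
    have hc := aux_isClosed_tendsto atTop (fun n => trans hT ^ n) 0 (trans_pow_opNorm hT)
    let Z : Submodule ℝ (Lp ℝ 2 μ) :=
      { carrier := {z | Tendsto (fun n => (trans hT ^ n) z) atTop (𝓝 0)}
        add_mem' := fun {a b} ha hb => by
          simpa using Tendsto.add ha hb
        zero_mem' := by simp
        smul_mem' := fun c a ha => by
          simpa only [Set.mem_ofPred_eq, map_smul, smul_zero] using Tendsto.const_smul ha c }
    have hKZ : K ≤ Z := by
      refine iSup_le fun n z hz => ?_
      refine tendsto_const_nhds.congr' ?_
      filter_upwards [eventually_ge_atTop n] with m hm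
      obtain ⟨k, rfl⟩ := Nat.exists_eq_add_of_le' hm
      rw [pow_add, mul_apply_eq_comp]
      rw [show (trans hT ^ n) z = 0 from hz, map_zero]
    exact Submodule.topologicalClosure_minimal K hKZ hc
  have hx0 : x - meanL μ x ∈ K.topologicalClosure := by
    rw [← Submodule.orthogonal_orthogonal_eq_closure, Submodule.mem_orthogonal]
    intro u hu
    have hker : ∀ n, ∀ z, (trans hT ^ n) z = 0 → inner ℝ z u = 0 := fun n z hz =>
      (Submodule.mem_orthogonal K u).1 hu z
        (Submodule.mem_iSup_of_mem n (show z ∈ (trans hT ^ n).ker from hz))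
    have hadj : ∀ n, ContinuousLinearMap.adjoint (koop hT ^ n) = trans hT ^ n := fun n => by
      rw [← ContinuousLinearMap.star_eq_adjoint, star_pow]; rfl
    obtain ⟨c, hc⟩ := exact_const hT hex u (fun n => (trans hT ^ n) u) (fun n => by
      set w := u - (koop hT ^ n) ((trans hT ^ n) u) with hw
      have hTw : (trans hT ^ n) w = 0 := by
        rw [hw, map_sub, ← mul_apply_eq_comp, trans_pow_koop_pow]; simp
      have h1 := hker n _ hTw
      have h2 : inner ℝ w ((koop hT ^ n) ((trans hT ^ n) u)) = 0 := by
        rw [← ContinuousLinearMap.adjoint_inner_left, hadj, hTw, inner_zero_left]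
      have h3 : inner ℝ w w = 0 := by
        conv_lhs => arg 3; rw [hw]
        rw [inner_sub_right, h1, h2, sub_zero]
      exact sub_eq_zero.1 (inner_self_eq_zero.1 h3))
    rw [hc, inner_smul_left, inner_sub_right, meanL_apply', inner_smul_right]
    have : inner ℝ (oneL μ) (oneL μ) = (1:ℝ) := by
      rw [inner_oneL, integral_congr_ae oneL_coe]; simp
    rw [this]; simp
  have := (hcl _ hx0).add_const (meanL μ x)
  simpa [map_sub, hfix] using this

end Aux

end VonMises

namespace VonMises

set_option linter.unusedSectionVars false

section Tens

variable {X : Type} [MeasurableSpace X] {μ : Measure X} [IsProbabilityMeasure μ] {T : X → X}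
  {E : Type} [NormedAddCommGroup E] [NormedSpace ℝ E] [CompleteSpace E]
  {tp : ContinuousMultilinearMap ℝ (fun _ : Fin 2 => Lp ℝ 2 μ) E}

lemma ptp_ext (hE : IsPTP μ (fun _ : Fin 2 => (2 : ℝ≥0∞)) E tp) {F : Type*}
    [NormedAddCommGroup F] [NormedSpace ℝ F] {A B : E →L[ℝ] F}
    (h : ∀ x, A (tp x) = B (tp x)) : A = B := by
  refine ContinuousLinearMap.ext_on hE.denseSpan ?_
  rintro _ ⟨x, rfl⟩
  exact h x

/-- Tensor product of two operators. -/
def tens (hE : IsPTP μ (fun _ : Fin 2 => (2 : ℝ≥0∞)) E tp)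
    (A : Fin 2 → (Lp ℝ 2 μ →L[ℝ] Lp ℝ 2 μ)) : E →L[ℝ] E :=
  Classical.choose (hE.lift E (tp.compContinuousLinearMap A))

lemma tens_tp (hE : IsPTP μ (fun _ : Fin 2 => (2 : ℝ≥0∞)) E tp)
    (A : Fin 2 → (Lp ℝ 2 μ →L[ℝ] Lp ℝ 2 μ)) (x : Fin 2 → Lp ℝ 2 μ) :
    tens hE A (tp x) = tp (fun i => A i (x i)) :=
  (Classical.choose_spec (hE.lift E (tp.compContinuousLinearMap A))).1 x

lemma tens_norm (hE : IsPTP μ (fun _ : Fin 2 => (2 : ℝ≥0∞)) E tp)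
    (A : Fin 2 → (Lp ℝ 2 μ →L[ℝ] Lp ℝ 2 μ)) (hA : ∀ i, ‖A i‖ ≤ 1) : ‖tens hE A‖ ≤ 1 := by
  rw [show ‖tens hE A‖ = _ from
    (Classical.choose_spec (hE.lift E (tp.compContinuousLinearMap A))).2]
  refine ContinuousMultilinearMap.opNorm_le_bound zero_le_one fun x => ?_
  rw [ContinuousMultilinearMap.compContinuousLinearMap_apply, hE.crossNorm, one_mul]
  refine Finset.prod_le_prod (fun i _ => norm_nonneg _) fun i _ => ?_
  exact ((A i).le_opNorm _).trans (mul_le_of_le_one_left (norm_nonneg _) (hA i))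

lemma tens_mul (hE : IsPTP μ (fun _ : Fin 2 => (2 : ℝ≥0∞)) E tp)
    (A B : Fin 2 → (Lp ℝ 2 μ →L[ℝ] Lp ℝ 2 μ)) :
    tens hE A * tens hE B = tens hE (fun i => A i * B i) :=
  ptp_ext hE fun x => by simp only [mul_apply_eq_comp, tens_tp]

lemma tens_one (hE : IsPTP μ (fun _ : Fin 2 => (2 : ℝ≥0∞)) E tp) :
    tens hE (fun _ => 1) = 1 :=
  ptp_ext hE fun x => by simp only [tens_tp, one_apply_eq_self]

lemma tens_tendsto (hE : IsPTP μ (fun _ : Fin 2 => (2 : ℝ≥0∞)) E tp) {ι : Type*} (l : Filter ι)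
    (A : ι → Fin 2 → (Lp ℝ 2 μ →L[ℝ] Lp ℝ 2 μ)) (A0 : Fin 2 → (Lp ℝ 2 μ →L[ℝ] Lp ℝ 2 μ))
    (hA : ∀ n i, ‖A n i‖ ≤ 1) (h : ∀ i x, Tendsto (fun n => A n i x) l (𝓝 (A0 i x))) (u : E) :
    Tendsto (fun n => tens hE (A n) u) l (𝓝 (tens hE A0 u)) := by
  have hc := aux_isClosed_tendsto l (fun n => tens hE (A n)) (tens hE A0)
    (fun n => tens_norm hE _ (hA n))
  have hd := hE.denseSpan
  let Z : Submodule ℝ E :=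
    { carrier := {z | Tendsto (fun n => tens hE (A n) z) l (𝓝 (tens hE A0 z))}
      add_mem' := fun {a b} ha hb => by
        simpa only [Set.mem_ofPred_eq, map_add] using Tendsto.add ha hb
      zero_mem' := by simpa using tendsto_const_nhds
      smul_mem' := fun c a ha => by
        simpa only [Set.mem_ofPred_eq, map_smul] using Tendsto.const_smul ha c }
  have hle : Submodule.span ℝ (Set.range fun f : Fin 2 → Lp ℝ 2 μ => tp f) ≤ Z := by
    rw [Submodule.span_le]
    rintro _ ⟨x, rfl⟩
    change Tendsto (fun n => tens hE (A n) (tp x)) l (𝓝 (tens hE A0 (tp x)))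
    simp only [tens_tp]
    exact (tp.cont.tendsto _).comp (tendsto_pi_nhds.2 fun i => h i (x i))
  exact (hc.closure_subset_iff.2 hle) (hd u)

lemma J_inner {J : E →L[ℝ] Lp ℝ 2 (pm μ 2)}
    (hJ : IsEmbed μ (fun _ : Fin 2 => (2 : ℝ≥0∞)) 2 tp J) (x y : Fin 2 → Lp ℝ 2 μ) :
    inner ℝ (J (tp x)) (J (tp y)) = ∏ i, inner ℝ (x i) (y i) := by
  simp only [L2.inner_def]
  rw [← integral_fintype_prod_eq_prod]
  refine integral_congr_ae ?_
  filter_upwards [hJ x, hJ y] with z h1 h2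
  rw [h1, h2]
  simp [Fin.prod_univ_two]; ring

lemma J_inj (hE : IsPTP μ (fun _ : Fin 2 => (2 : ℝ≥0∞)) E tp)
    {J : E →L[ℝ] Lp ℝ 2 (pm μ 2)}
    (hJ : IsEmbed μ (fun _ : Fin 2 => (2 : ℝ≥0∞)) 2 tp J) {u : E} (hu : J u = 0) : u = 0 := by
  obtain ⟨w, b, -⟩ := exists_hilbertBasis ℝ (Lp ℝ 2 μ)
  let P : Finset w → (Lp ℝ 2 μ →L[ℝ] Lp ℝ 2 μ) := fun s =>
    ∑ i ∈ s, (innerSL ℝ (b i)).smulRight (b i)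
  have hPa : ∀ s x, P s x = ∑ i ∈ s, (inner ℝ (b i) x : ℝ) • b i := fun s x => by
    simp [P]
  have hPn : ∀ s, ‖P s‖ ≤ 1 := fun s => by
    refine ContinuousLinearMap.opNorm_le_bound _ zero_le_one fun x => ?_
    rw [one_mul, hPa]
    have h1 := b.orthonormal.sum_inner_products_le (s := s) x
    refine le_of_sq_le_sq ?_ (norm_nonneg x)
    refine le_trans (le_of_eq ?_) h1
    rw [← real_inner_self_eq_norm_sq, b.orthonormal.inner_sum]
    refine Finset.sum_congr rfl fun i _ => ?_
    simp [sq]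
  have hPt : ∀ x, Tendsto (fun s => P s x) atTop (𝓝 x) := fun x => by
    have := b.hasSum_repr x
    simp only [HilbertBasis.repr_apply_apply] at this
    simpa only [hPa, HasSum, SummationFilter.unconditional_filter] using this
  have hlim := tens_tendsto hE atTop (fun s _ => P s) (fun _ => 1) (fun s _ => hPn s)
    (fun _ x => by simpa using hPt x) u
  have hz : ∀ s, tens hE (fun _ => P s) u = 0 := fun s => by
    have : tens hE (fun _ => P s) = ∑ r ∈ Fintype.piFinset (fun _ : Fin 2 => s),
        ((innerSL ℝ (J (tp fun i => b (r i)))).comp J).smulRight (tp fun i => b (r i)) := by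
      refine ptp_ext hE fun x => ?_
      rw [tens_tp]
      simp only [hPa]
      rw [ContinuousMultilinearMap.map_sum_finset]
      rw [sum_apply]
      refine Finset.sum_congr rfl fun r _ => ?_
      rw [ContinuousMultilinearMap.map_smul_univ]
      simp only [ContinuousLinearMap.smulRight_apply, ContinuousLinearMap.comp_apply,
        innerSL_apply_apply, J_inner hJ]
    rw [this, sum_apply]
    refine Finset.sum_eq_zero fun r _ => ?_
    simp [hu]
  simp only [hz, tens_one, one_apply_eq_self] at hlim
  exact (tendsto_nhds_unique hlim tendsto_const_nhds)

lemma J_inj' (hE : IsPTP μ (fun _ : Fin 2 => (2 : ℝ≥0∞)) E tp)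
    {J : E →L[ℝ] Lp ℝ 2 (pm μ 2)}
    (hJ : IsEmbed μ (fun _ : Fin 2 => (2 : ℝ≥0∞)) 2 tp J) {u v : E} (h : J u = J v) : u = v :=
  sub_eq_zero.1 (J_inj hE hJ (by rw [map_sub, h, sub_self]))

lemma WK_eq (hE : IsPTP μ (fun _ : Fin 2 => (2 : ℝ≥0∞)) E tp) (hT : MeasurePreserving T μ μ)
    {W : E →L[ℝ] E} {k : Fin 2 → ℕ}
    (hW : IsTKoop μ (fun _ : Fin 2 => (2 : ℝ≥0∞)) tp (fun _ => T) k W) :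
    W = tens hE (fun i => koop hT ^ k i) :=
  ptp_ext hE fun x => by
    rw [tens_tp]; exact hW _ _ fun i => koop_pow_coe hT (k i) (x i)

lemma WT_eq (hE : IsPTP μ (fun _ : Fin 2 => (2 : ℝ≥0∞)) E tp) (hT : MeasurePreserving T μ μ)
    {W : E →L[ℝ] E} {k : Fin 2 → ℕ}
    (hW : IsTTrans μ (fun _ : Fin 2 => (2 : ℝ≥0∞)) tp (fun _ => T) k W) :
    W = tens hE (fun i => trans hT ^ k i) :=
  ptp_ext hE fun x => by
    rw [tens_tp]; exact hW _ _ fun i => trans_isTransfer hT (k i) (x i)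

end Tens

end VonMises

namespace VonMises

set_option linter.unusedSectionVars false

section Cond

variable {X : Type} [MeasurableSpace X] {μ : Measure X} [IsProbabilityMeasure μ] {T : X → X}
  {E : Type} [NormedAddCommGroup E] [NormedSpace ℝ E] [CompleteSpace E]
  {tp : ContinuousMultilinearMap ℝ (fun _ : Fin 2 => Lp ℝ 2 μ) E}

/-- Integration over a measurable set as a continuous functional. -/
def setI {Y : Type*} [MeasurableSpace Y] (ν : Measure Y) [IsProbabilityMeasure ν] {s : Set Y}
    (hs : MeasurableSet s) : Lp ℝ 2 ν →L[ℝ] ℝ :=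
  innerSL ℝ (indicatorConstLp 2 hs (measure_ne_top ν _) (1 : ℝ))

lemma setI_apply {Y : Type*} [MeasurableSpace Y] (ν : Measure Y) [IsProbabilityMeasure ν]
    {s : Set Y} (hs : MeasurableSet s) (x : Lp ℝ 2 ν) : setI ν hs x = ∫ y in s, x y ∂ν := by
  rw [setI, innerSL_apply_apply, L2.inner_indicatorConstLp_one]

lemma lp_integrable {Y : Type*} [MeasurableSpace Y] {ν : Measure Y} [IsProbabilityMeasure ν]
    (x : Lp ℝ 2 ν) : Integrable x ν :=
  (Lp.memLp x).integrable one_le_two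

lemma rect_integral {J : E →L[ℝ] Lp ℝ 2 (pm μ 2)}
    (hJ : IsEmbed μ (fun _ : Fin 2 => (2 : ℝ≥0∞)) 2 tp J) (x : Fin 2 → Lp ℝ 2 μ)
    (s : Fin 2 → Set X) :
    ∫ z in Set.pi Set.univ s, J (tp x) z ∂(pm μ 2) = ∏ i, ∫ y in s i, x i y ∂μ := by
  rw [integral_congr_ae (ae_restrict_of_ae (hJ x)), pm, Measure.restrict_pi_pi]
  exact integral_fintype_prod_eq_prod (fun i y => (x i : X → ℝ) y)

lemma rect_transfer (hE : IsPTP μ (fun _ : Fin 2 => (2 : ℝ≥0∞)) E tp)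
    {J : E →L[ℝ] Lp ℝ 2 (pm μ 2)}
    (hJ : IsEmbed μ (fun _ : Fin 2 => (2 : ℝ≥0∞)) 2 tp J) (S : Fin 2 → X → X)
    (hS : ∀ i, Measurable (S i)) (A : Fin 2 → (Lp ℝ 2 μ →L[ℝ] Lp ℝ 2 μ))
    (hA : ∀ i x s, MeasurableSet s → ∫ y in s, A i x y ∂μ = ∫ y in S i ⁻¹' s, x y ∂μ)
    (u : E) (t : Set (Fin 2 → X)) (ht : MeasurableSet t) :
    ∫ z in t, J (tens hE A u) z ∂(pm μ 2)
      = ∫ z in (fun z i => S i (z i)) ⁻¹' t, J u z ∂(pm μ 2) := by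
  have hSm : Measurable (fun (z : Fin 2 → X) i => S i (z i)) :=
    measurable_pi_lambda _ fun i => (hS i).comp (measurable_pi_apply i)
  have hrect : ∀ s : Fin 2 → Set X, (∀ i, MeasurableSet (s i)) →
      ∫ z in Set.pi Set.univ s, J (tens hE A u) z ∂(pm μ 2)
      = ∫ z in (fun z i => S i (z i)) ⁻¹' (Set.pi Set.univ s), J u z ∂(pm μ 2) := by
    intro s hs
    have hms : MeasurableSet (Set.pi Set.univ s) := MeasurableSet.univ_pi hs
    have heq : ((setI (pm μ 2) hms).comp J).comp (tens hE A)
        = (setI (pm μ 2) (hSm hms)).comp J := by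
      refine ptp_ext hE fun x => ?_
      simp only [ContinuousLinearMap.comp_apply, setI_apply, tens_tp]
      rw [rect_integral hJ]
      rw [show (fun (z : Fin 2 → X) i => S i (z i)) ⁻¹' (Set.pi Set.univ s)
        = Set.pi Set.univ (fun i => S i ⁻¹' s i) from rfl, rect_integral hJ]
      exact Finset.prod_congr rfl fun i _ => hA i _ _ (hs i)
    have := DFunLike.congr_fun heq u
    simpa only [ContinuousLinearMap.comp_apply, setI_apply] using this
  have hI1 := lp_integrable (J (tens hE A u))
  have hI2 := lp_integrable (J u)
  induction t, ht using MeasurableSpace.induction_on_inter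
    (generateFrom_pi (α := fun _ : Fin 2 => X)).symm isPiSystem_pi with
  | empty => simp
  | basic t ht =>
    obtain ⟨s, hs, rfl⟩ := ht
    exact hrect s fun i => hs i (Set.mem_univ i)
  | compl t htm ih =>
    have hu := hrect (fun _ => Set.univ) (fun _ => MeasurableSet.univ)
    simp only [Set.pi_univ, Set.preimage_univ, setIntegral_univ] at hu
    have h1 := integral_add_compl htm hI1
    have h2 := integral_add_compl (hSm htm) hI2
    rw [Set.preimage_compl]
    linarith
  | iUnion t hd htm ih =>
    rw [Set.preimage_iUnion, integral_iUnion htm hd hI1.integrableOn,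
      integral_iUnion (fun i => hSm (htm i)) (fun i j hij => (hd hij).preimage _)
        hI2.integrableOn]
    exact tsum_congr ih

lemma cond_iff (hE : IsPTP μ (fun _ : Fin 2 => (2 : ℝ≥0∞)) E tp)
    {J : E →L[ℝ] Lp ℝ 2 (pm μ 2)}
    (hJ : IsEmbed μ (fun _ : Fin 2 => (2 : ℝ≥0∞)) 2 tp J) (S : Fin 2 → X → X)
    (hS : ∀ i, Measurable (S i)) (A : Fin 2 → (Lp ℝ 2 μ →L[ℝ] Lp ℝ 2 μ))
    (hA : ∀ i x s, MeasurableSet s → ∫ y in s, A i x y ∂μ = ∫ y in S i ⁻¹' s, x y ∂μ)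
    (u : E) :
    ((pm μ 2)[(J u : (Fin 2 → X) → ℝ) |
        MeasurableSpace.comap (fun (z : Fin 2 → X) i => S i (z i)) inferInstance]
        =ᵐ[pm μ 2] 0) ↔ tens hE A u = 0 := by
  have hSm : Measurable (fun (z : Fin 2 → X) i => S i (z i)) :=
    measurable_pi_lambda _ fun i => (hS i).comp (measurable_pi_apply i)
  have hm := hSm.comap_le
  have hI := lp_integrable (J u)
  constructor
  · intro h
    refine J_inj hE hJ ?_
    refine (Lp.eq_zero_iff_ae_eq_zero).2 ?_
    refine (lp_integrable _).ae_eq_of_forall_setIntegral_eq _ _ (integrable_zero _ _ _)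
      fun t ht _ => ?_
    rw [rect_transfer hE hJ S hS A hA u t ht,
      ← setIntegral_condExp hm hI ⟨t, ht, rfl⟩, integral_congr_ae (ae_restrict_of_ae h)]
    simp
  · intro h
    refine (ae_eq_condExp_of_forall_setIntegral_eq hm hI (fun s _ _ => integrableOn_zero) ?_
      aestronglyMeasurable_zero).symm
    rintro _ ⟨t, ht, rfl⟩ _
    rw [← rect_transfer hE hJ S hS A hA u t ht, h, map_zero,
      integral_congr_ae (ae_restrict_of_ae (Lp.coeFn_zero ℝ 2 (pm μ 2)))]
    simp

lemma update_mp (l : Fin 2) :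
    MeasurePreserving (fun p : (Fin 2 → X) × X => Function.update p.1 l p.2)
      ((pm μ 2).prod μ) (pm μ 2) := by
  have hm : Measurable (fun p : (Fin 2 → X) × X => Function.update p.1 l p.2) := by
    refine measurable_pi_lambda _ fun i => ?_
    by_cases h : i = l
    · subst h; simpa using measurable_snd
    · simp only [Function.update_of_ne h]
      exact (measurable_pi_apply i).comp measurable_fst
  refine ⟨hm, (Measure.pi_eq fun s hs => ?_).symm⟩
  rw [Measure.map_apply hm (MeasurableSet.univ_pi hs)]
  have : (fun p : (Fin 2 → X) × X => Function.update p.1 l p.2) ⁻¹' (Set.pi Set.univ s)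
      = (Set.pi Set.univ (Function.update s l Set.univ)) ×ˢ (s l) := by
    ext p
    fin_cases l <;> simp [Set.mem_pi, Fin.forall_fin_two, and_comm]
  rw [this, Measure.prod_prod, pm, Measure.pi_pi]
  fin_cases l <;> simp [Fin.prod_univ_two, mul_comm]

lemma meanL_coe (x : Lp ℝ 2 μ) : (meanL μ x : X → ℝ) =ᵐ[μ] fun _ => ∫ y, x y ∂μ := by
  rw [meanL_apply]
  filter_upwards [Lp.coeFn_smul (∫ y, x y ∂μ) (oneL μ), oneL_coe (μ := μ)] with z h1 h2
  rw [h1]; simp [h2]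

/-- Operators integrating out a variable. -/
def Pl (hE : IsPTP μ (fun _ : Fin 2 => (2 : ℝ≥0∞)) E tp) (l : Fin 2) : E →L[ℝ] E :=
  tens hE (Function.update (fun _ => 1) l (meanL μ))

lemma Pl_coe (hE : IsPTP μ (fun _ : Fin 2 => (2 : ℝ≥0∞)) E tp)
    {J : E →L[ℝ] Lp ℝ 2 (pm μ 2)}
    (hJ : IsEmbed μ (fun _ : Fin 2 => (2 : ℝ≥0∞)) 2 tp J) (l : Fin 2) (u : E) :
    (fun z => ∫ y, J u (Function.update z l y) ∂μ) =ᵐ[pm μ 2] J (Pl hE l u) := by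
  have hΦ := update_mp (μ := μ) l
  have hint : ∀ v : E, Integrable (fun p : (Fin 2 → X) × X => J v (Function.update p.1 l p.2))
      ((pm μ 2).prod μ) := fun v => hΦ.integrable_comp_of_integrable (lp_integrable (J v))
  refine (hint u).integral_prod_left.ae_eq_of_forall_setIntegral_eq _ _ (lp_integrable _)
    fun t ht _ => ?_
  have hset : ∀ v, ∫ z in t, ∫ y, J v (Function.update z l y) ∂μ ∂(pm μ 2)
      = ∫ p in t ×ˢ Set.univ, J v (Function.update p.1 l p.2) ∂((pm μ 2).prod μ) := fun v => by
    rw [setIntegral_prod _ (hint v).integrableOn]; simp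
  have htu : MeasurableSet (t ×ˢ (Set.univ : Set X)) := ht.prod MeasurableSet.univ
  let C : Lp ℝ 2 (pm μ 2) →L[ℝ] Lp ℝ 2 ((pm μ 2).prod μ) :=
    (Lp.compMeasurePreservingₗᵢ ℝ _ hΦ).toContinuousLinearMap
  have hC : ∀ v, ((setI ((pm μ 2).prod μ) htu).comp (C.comp J)) v
      = ∫ z in t, ∫ y, J v (Function.update z l y) ∂μ ∂(pm μ 2) := fun v => by
    rw [hset v]
    simp only [ContinuousLinearMap.comp_apply, setI_apply]
    exact integral_congr_ae (ae_restrict_of_ae (Lp.coeFn_compMeasurePreserving (J v) hΦ))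
  have heq : (setI ((pm μ 2).prod μ) htu).comp (C.comp J)
      = ((setI (pm μ 2) ht).comp J).comp (Pl hE l) := by
    refine ptp_ext hE fun x => ?_
    rw [hC]
    simp only [ContinuousLinearMap.comp_apply, setI_apply, Pl, tens_tp]
    refine integral_congr_ae (ae_restrict_of_ae ?_)
    have h1 := Measure.ae_ae_of_ae_prod (hΦ.quasiMeasurePreserving.ae (hJ x))
    have h2 := (measurePreserving_eval (fun _ : Fin 2 => μ) l).quasiMeasurePreserving.ae
      (meanL_coe (x l))
    filter_upwards [h1, h2, hJ (fun i => (Function.update (fun _ => 1) l (meanL μ) :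
      Fin 2 → (Lp ℝ 2 μ →L[ℝ] Lp ℝ 2 μ)) i (x i))] with z h1 h2 h3
    rw [integral_congr_ae h1, h3]
    simp only [Function.eval] at h2
    fin_cases l
    · simp at h2
      simp [Fin.prod_univ_two, integral_mul_const, h2]
    · simp at h2
      simp [Fin.prod_univ_two, integral_const_mul, h2]
  rw [← hC u, heq]
  simp only [ContinuousLinearMap.comp_apply, setI_apply]

lemma canon_iff (hE : IsPTP μ (fun _ : Fin 2 => (2 : ℝ≥0∞)) E tp)
    {J : E →L[ℝ] Lp ℝ 2 (pm μ 2)}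
    (hJ : IsEmbed μ (fun _ : Fin 2 => (2 : ℝ≥0∞)) 2 tp J) (u : E) :
    Canonical μ 2 (J u : (Fin 2 → X) → ℝ) ↔ ∀ l, Pl hE l u = 0 := by
  refine forall_congr' fun l => ?_
  constructor
  · intro h
    refine J_inj hE hJ ((Lp.eq_zero_iff_ae_eq_zero).2 ?_)
    filter_upwards [h, Pl_coe hE hJ l u] with z h1 h2
    rw [← h2, h1]; rfl
  · intro h
    filter_upwards [Pl_coe hE hJ l u, Lp.coeFn_zero ℝ 2 (pm μ 2)] with z h1 h2
    rw [h1, h, map_zero, h2]; rfl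

/-- The flip operator. -/
def flip (hE : IsPTP μ (fun _ : Fin 2 => (2 : ℝ≥0∞)) E tp) : E →L[ℝ] E :=
  Classical.choose (hE.lift E (tp.domDomCongr (Equiv.swap 0 1)))

lemma flip_tp (hE : IsPTP μ (fun _ : Fin 2 => (2 : ℝ≥0∞)) E tp) (x : Fin 2 → Lp ℝ 2 μ) :
    flip hE (tp x) = tp (fun i => x (Equiv.swap 0 1 i)) :=
  (Classical.choose_spec (hE.lift E (tp.domDomCongr (Equiv.swap 0 1)))).1 x

lemma flip_tens (hE : IsPTP μ (fun _ : Fin 2 => (2 : ℝ≥0∞)) E tp)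
    (A : Fin 2 → (Lp ℝ 2 μ →L[ℝ] Lp ℝ 2 μ)) :
    flip hE * tens hE A = tens hE (fun i => A (Equiv.swap 0 1 i)) * flip hE :=
  ptp_ext hE fun x => by simp only [mul_apply_eq_comp, tens_tp, flip_tp]

lemma swap_mp : MeasurePreserving (fun (z : Fin 2 → X) => ![z 1, z 0]) (pm μ 2) (pm μ 2) := by
  have hm : Measurable (fun (z : Fin 2 → X) => ![z 1, z 0]) := by
    refine measurable_pi_lambda _ fun i => ?_
    fin_cases i
    · exact measurable_pi_apply 1
    · exact measurable_pi_apply 0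
  refine ⟨hm, (Measure.pi_eq fun s hs => ?_).symm⟩
  rw [Measure.map_apply hm (MeasurableSet.univ_pi hs)]
  have : (fun (z : Fin 2 → X) => ![z 1, z 0]) ⁻¹' (Set.pi Set.univ s)
      = Set.pi Set.univ ![s 1, s 0] := by
    ext p
    simp only [Set.mem_preimage, Set.mem_pi, Set.mem_univ, true_implies, Fin.forall_fin_two]
    simp only [Matrix.cons_val_zero, Matrix.cons_val_one]
    exact and_comm
  rw [this, pm, Measure.pi_pi]
  simp [Fin.prod_univ_two, mul_comm]

lemma flip_coe (hE : IsPTP μ (fun _ : Fin 2 => (2 : ℝ≥0∞)) E tp)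
    {J : E →L[ℝ] Lp ℝ 2 (pm μ 2)}
    (hJ : IsEmbed μ (fun _ : Fin 2 => (2 : ℝ≥0∞)) 2 tp J) (u : E) :
    (fun z : Fin 2 → X => (J u : (Fin 2 → X) → ℝ) ![z 1, z 0]) =ᵐ[pm μ 2] J (flip hE u) := by
  have heq : (Lp.compMeasurePreservingₗᵢ ℝ _ (swap_mp (μ := μ))).toContinuousLinearMap.comp J
      = J.comp (flip hE) := by
    refine ptp_ext hE fun x => Lp.ext ?_
    refine (Lp.coeFn_compMeasurePreserving (J (tp x)) swap_mp).trans ?_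
    simp only [ContinuousLinearMap.comp_apply, flip_tp]
    filter_upwards [hJ (fun i => x (Equiv.swap 0 1 i)),
      swap_mp.quasiMeasurePreserving.ae (hJ x)] with z h1 h2
    rw [h1, Function.comp_apply, h2]
    simp [Fin.prod_univ_two, mul_comm]
  rw [show J (flip hE u) = _ from (DFunLike.congr_fun heq u).symm]
  exact (Lp.coeFn_compMeasurePreserving (J u) swap_mp).symm

end Cond

end VonMises

namespace VonMises

set_option linter.unusedSectionVars false

section Core

variable {E : Type} [NormedAddCommGroup E] [NormedSpace ℝ E]
  {U V P : Fin 2 → (E →L[ℝ] E)}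

lemma core_fix {U P : E →L[ℝ] E}
    (lim : ∀ h, P h = 0 → Tendsto (fun n => (U ^ n) h) atTop (𝓝 0)) {h : E} (hP : P h = 0)
    (hU : U h = h) : h = 0 := by
  have : ∀ n : ℕ, (U ^ n) h = h := fun n => by
    induction n with
    | zero => simp
    | succ n ih => rw [pow_succ, mul_apply_eq_comp, hU, ih]
  have h1 := lim h hP
  simp only [this] at h1
  exact tendsto_nhds_unique tendsto_const_nhds h1

lemma core_uniq (hUV : ∀ i h, U i (V i h) = h)
    (cUU : ∀ h, U 0 (U 1 h) = U 1 (U 0 h))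
    (cUV10 : ∀ h, U 1 (V 0 h) = V 0 (U 1 h))
    (lim : ∀ i h, P i h = 0 → Tendsto (fun n => (U i ^ n) h) atTop (𝓝 0))
    (PU : ∀ i j h, P i h = 0 → P i (U j h) = 0)
    {a b c d : E}
    (heq : a + (V 0 - 1) b + (V 1 - 1) c + ((V 0 - 1) * (V 1 - 1)) d = 0)
    (ha0 : U 0 a = 0) (ha1 : U 1 a = 0) (hb : U 1 b = 0) (hc : U 0 c = 0)
    (Pb : ∀ i, P i b = 0) (Pc : ∀ i, P i c = 0) (Pd : ∀ i, P i d = 0) :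
    a = 0 ∧ b = 0 ∧ c = 0 ∧ d = 0 := by
  simp only [mul_apply_eq_comp, sub_apply, one_apply_eq_self, map_sub] at heq
  have hd : d = 0 := by
    have h1 := congrArg (U 0) (congrArg (U 1) heq)
    simp only [map_add, map_sub, map_zero, ha1, cUV10, hb, hUV, hc, cUU] at h1
    have h2 : d - U 1 d = 0 := by
      refine core_fix (lim 0) (h := d - U 1 d) ?_ ?_
      · rw [map_sub, Pd, PU 0 1 d (Pd 0), sub_zero]
      · rw [map_sub, cUU]
        have : d - U 1 d - (U 0 d - U 1 (U 0 d)) = 0 := by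
          rw [← h1]; abel
        exact (sub_eq_zero.1 this).symm
    exact core_fix (lim 1) (Pd 1) (sub_eq_zero.1 h2).symm
  subst hd
  have hc0 : c = 0 := by
    have h1 := congrArg (U 1) heq
    simp only [map_add, map_sub, map_zero, ha1, cUV10, hb, hUV] at h1
    exact core_fix (lim 1) (Pc 1) (sub_eq_zero.1 (by rw [← h1]; abel)).symm
  subst hc0
  have hb0 : b = 0 := by
    have h1 := congrArg (U 0) heq
    simp only [map_add, map_sub, map_zero, ha0, hUV] at h1
    exact core_fix (lim 0) (Pb 0) (sub_eq_zero.1 (by rw [← h1]; abel)).symm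
  subst hb0
  refine ⟨?_, rfl, rfl, rfl⟩
  simpa using heq

lemma core_sum (U0 U1 : E →L[ℝ] E) (f : E) (n : Fin 2 → ℕ) :
    ∑ k ∈ Fintype.piFinset (fun i => Finset.range (n i)), (U0 ^ k 0 * U1 ^ k 1) f
      = ((∑ i ∈ Finset.range (n 0), U0 ^ i) * (∑ j ∈ Finset.range (n 1), U1 ^ j)) f := by
  rw [Finset.sum_mul_sum, ← Finset.sum_product', sum_apply]
  refine Finset.sum_nbij' (fun k => (k 0, k 1)) (fun p => ![p.1, p.2]) ?_ ?_ ?_ ?_ ?_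
  · intro k hk
    rw [Fintype.mem_piFinset] at hk
    exact Finset.mem_product.2 ⟨hk 0, hk 1⟩
  · intro p hp
    rw [Finset.mem_product] at hp
    rw [Fintype.mem_piFinset]
    intro i
    fin_cases i
    · exact hp.1
    · exact hp.2
  · intro k _
    ext i
    fin_cases i <;> rfl
  · intro p _; rfl
  · intro k _; rfl

lemma core_exists (cUU : U 0 * U 1 = U 1 * U 0)
    (nU : ∀ n : ℕ, ‖U 0 ^ n‖ ≤ 1)
    (lim : ∀ i h, P i h = 0 → Tendsto (fun n => (U i ^ n) h) atTop (𝓝 0))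
    (PU : ∀ i j h, P i h = 0 → P i (U j h) = 0) {f g : E} (Pf : ∀ i, P i f = 0)
    (hg : Tendsto (fun n : Fin 2 → ℕ =>
        ∑ k ∈ Fintype.piFinset (fun i => Finset.range (n i)), (U 0 ^ k 0 * U 1 ^ k 1) f)
          atTop (𝓝 g)) :
    f = ((1 - U 0) * (1 - U 1)) g ∧ ∀ i, P i g = 0 := by
  have hdiag : Tendsto (fun (m : ℕ) (_ : Fin 2) => m) atTop atTop :=
    tendsto_atTop_atTop.2 fun b => ⟨max (b 0) (b 1), fun m hm i => by
      fin_cases i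
      · exact (le_max_left _ _).trans hm
      · exact (le_max_right _ _).trans hm⟩
  have hg2 := hg.comp hdiag
  constructor
  · have h1 := ((((1 - U 0) * (1 - U 1)) : E →L[ℝ] E).continuous.tendsto g).comp hg2
    have h2 : ∀ m : ℕ, ((1 - U 0) * (1 - U 1)) (∑ k ∈ Fintype.piFinset
        (fun _ : Fin 2 => Finset.range m), (U 0 ^ k 0 * U 1 ^ k 1) f)
        = f - (U 1 ^ m) f - (U 0 ^ m) f + (U 0 ^ m) ((U 1 ^ m) f) := fun m => by
      rw [core_sum (U 0) (U 1) f (fun _ => m), ← mul_apply_eq_comp]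
      have hc : Commute (1 - U 1) (∑ i ∈ Finset.range m, U 0 ^ i) := by
        refine Commute.sum_right _ _ _ fun i _ => ?_
        refine (Commute.one_left _).sub_left ?_
        exact (show Commute (U 1) (U 0) from cUU.symm).pow_right i
      have : (1 - U 0) * (1 - U 1) * ((∑ i ∈ Finset.range m, U 0 ^ i) *
          (∑ j ∈ Finset.range m, U 1 ^ j)) = (1 - U 0 ^ m) * (1 - U 1 ^ m) := by
        rw [← mul_neg_geom_sum, ← mul_neg_geom_sum, mul_assoc, ← mul_assoc (1 - U 1), hc.eq]
        simp only [mul_assoc]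
      rw [this]
      simp only [mul_apply_eq_comp, sub_apply, one_apply_eq_self, map_sub]
      abel
    have h3 : Tendsto (fun m : ℕ => f - (U 1 ^ m) f - (U 0 ^ m) f + (U 0 ^ m) ((U 1 ^ m) f))
        atTop (𝓝 (f - 0 - 0 + 0)) := by
      refine ((tendsto_const_nhds.sub (lim 1 f (Pf 1))).sub (lim 0 f (Pf 0))).add ?_
      refine squeeze_zero_norm (fun m => ?_) (tendsto_norm_zero.comp (lim 1 f (Pf 1)))
      exact ((U 0 ^ m).le_opNorm _).trans (mul_le_of_le_one_left (norm_nonneg _) (nU m))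
    have h4 := tendsto_nhds_unique (h1.congr fun m => h2 m) h3
    rw [h4]; simp
  · intro i
    have h1 := ((P i).continuous.tendsto g).comp hg
    have hpow : ∀ (j : Fin 2) (n : ℕ) h, P i h = 0 → P i ((U j ^ n) h) = 0 := fun j n => by
      induction n with
      | zero => intro h hh; simpa using hh
      | succ n ih => intro h hh; rw [pow_succ, mul_apply_eq_comp]; exact ih _ (PU i j h hh)
    have h2 : ∀ n : Fin 2 → ℕ, P i (∑ k ∈ Fintype.piFinset (fun i => Finset.range (n i)),
        (U 0 ^ k 0 * U 1 ^ k 1) f) = 0 := fun n => by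
      rw [map_sum]
      refine Finset.sum_eq_zero fun k _ => ?_
      rw [mul_apply_eq_comp]
      exact hpow _ _ _ (hpow _ _ _ (Pf i))
    exact tendsto_nhds_unique (h1.congr fun n => h2 n) tendsto_const_nhds |>.trans rfl

end Core

section Ops

variable {X : Type} [MeasurableSpace X] {μ : Measure X} [IsProbabilityMeasure μ] {T : X → X}
  {E : Type} [NormedAddCommGroup E] [NormedSpace ℝ E] [CompleteSpace E]
  {tp : ContinuousMultilinearMap ℝ (fun _ : Fin 2 => Lp ℝ 2 μ) E}

/-- An operator acting on one coordinate. -/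
def coordOp (hE : IsPTP μ (fun _ : Fin 2 => (2 : ℝ≥0∞)) E tp) (l : Fin 2)
    (A : Lp ℝ 2 μ →L[ℝ] Lp ℝ 2 μ) : E →L[ℝ] E :=
  tens hE (Function.update (fun _ => 1) l A)

lemma coordOp_mul (hE : IsPTP μ (fun _ : Fin 2 => (2 : ℝ≥0∞)) E tp) (l : Fin 2)
    (A B : Lp ℝ 2 μ →L[ℝ] Lp ℝ 2 μ) :
    coordOp hE l A * coordOp hE l B = coordOp hE l (A * B) := by
  rw [coordOp, coordOp, coordOp, tens_mul]
  congr 1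
  ext1 i
  by_cases h : i = l
  · subst h; simp
  · simp [h]

lemma coordOp_one (hE : IsPTP μ (fun _ : Fin 2 => (2 : ℝ≥0∞)) E tp) (l : Fin 2) :
    coordOp hE l 1 = 1 := by
  rw [coordOp, Function.update_eq_self, tens_one]

lemma coordOp_pow (hE : IsPTP μ (fun _ : Fin 2 => (2 : ℝ≥0∞)) E tp) (l : Fin 2)
    (A : Lp ℝ 2 μ →L[ℝ] Lp ℝ 2 μ) (n : ℕ) :
    coordOp hE l A ^ n = coordOp hE l (A ^ n) := by
  induction n with
  | zero => simp [coordOp_one]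
  | succ n ih => rw [pow_succ, ih, coordOp_mul, ← pow_succ]

lemma coordOp_comm (hE : IsPTP μ (fun _ : Fin 2 => (2 : ℝ≥0∞)) E tp) {l m : Fin 2} (hlm : l ≠ m)
    (A B : Lp ℝ 2 μ →L[ℝ] Lp ℝ 2 μ) :
    coordOp hE l A * coordOp hE m B = coordOp hE m B * coordOp hE l A := by
  rw [coordOp, coordOp, tens_mul, tens_mul]
  congr 1
  ext1 i
  by_cases h : i = l
  · subst h; simp [hlm]
  · by_cases h' : i = m
    · subst h'; simp [h]
    · simp [h]

lemma coordOp_two (hE : IsPTP μ (fun _ : Fin 2 => (2 : ℝ≥0∞)) E tp)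
    (A : Fin 2 → (Lp ℝ 2 μ →L[ℝ] Lp ℝ 2 μ)) :
    tens hE A = coordOp hE 0 (A 0) * coordOp hE 1 (A 1) := by
  rw [coordOp, coordOp, tens_mul]
  congr 1
  ext1 i
  fin_cases i <;> simp

lemma coordOp_norm (hE : IsPTP μ (fun _ : Fin 2 => (2 : ℝ≥0∞)) E tp) (l : Fin 2)
    (A : Lp ℝ 2 μ →L[ℝ] Lp ℝ 2 μ) (hA : ‖A‖ ≤ 1) : ‖coordOp hE l A‖ ≤ 1 := by
  refine tens_norm hE _ fun i => ?_
  by_cases h : i = l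
  · subst h; simpa using hA
  · rw [Function.update_of_ne h]; exact ContinuousLinearMap.norm_id_le

lemma flip_coordOp (hE : IsPTP μ (fun _ : Fin 2 => (2 : ℝ≥0∞)) E tp) (l : Fin 2)
    (A : Lp ℝ 2 μ →L[ℝ] Lp ℝ 2 μ) (h : E) :
    flip hE (coordOp hE l A h) = coordOp hE (Equiv.swap 0 1 l) A (flip hE h) := by
  rw [← mul_apply_eq_comp, ← mul_apply_eq_comp, coordOp, coordOp, flip_tens]
  congr 2
  congr 1
  ext1 i
  fin_cases i <;> fin_cases l <;> simp

lemma coordOp_lim (hE : IsPTP μ (fun _ : Fin 2 => (2 : ℝ≥0∞)) E tp)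
    (hT : MeasurePreserving T μ μ) (hex : Exact μ T) (l : Fin 2) (h : E) :
    Tendsto (fun n => (coordOp hE l (trans hT) ^ n) h) atTop (𝓝 (coordOp hE l (meanL μ) h)) := by
  simp only [coordOp_pow]
  refine tens_tendsto hE atTop (fun n => Function.update (fun _ => 1) l (trans hT ^ n)) _ ?_ ?_ h
  · intro n i
    by_cases h : i = l
    · subst h; simpa using trans_pow_opNorm hT n
    · rw [Function.update_of_ne h]; exact ContinuousLinearMap.norm_id_le
  · intro i x
    by_cases h : i = l
    · subst h; simpa using trans_tendsto hT hex x
    · simp [h]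

lemma cond_iff' (hE : IsPTP μ (fun _ : Fin 2 => (2 : ℝ≥0∞)) E tp)
    {J : E →L[ℝ] Lp ℝ 2 (pm μ 2)}
    (hJ : IsEmbed μ (fun _ : Fin 2 => (2 : ℝ≥0∞)) 2 tp J) (hT : MeasurePreserving T μ μ)
    (l : Fin 2) (u : E) {τ : (Fin 2 → X) → (Fin 2 → X)}
    (hτ : τ = fun z i => (Function.update (fun _ => id) l T : Fin 2 → X → X) i (z i)) :
    ((pm μ 2)[(J u : (Fin 2 → X) → ℝ) | MeasurableSpace.comap τ inferInstance]
        =ᵐ[pm μ 2] 0) ↔ coordOp hE l (trans hT) u = 0 := by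
  subst hτ
  refine cond_iff hE hJ _ ?_ _ ?_ u
  · intro i
    by_cases h : i = l
    · subst h; simpa using hT.measurable
    · simpa [h] using measurable_id
  · intro i x s hs
    by_cases h : i = l
    · subst h
      have := trans_isTransfer hT 1 x s hs
      simpa using this
    · simp [h]

end Ops

end VonMises

namespace VonMises

/-- Proposition 7: the martingale–coboundary decomposition for a
symmetric canonical kernel of degree 2 with convergent transfer series: existence,
uniqueness and symmetry of the components. -/
theorem statement17
    {X : Type} [MeasurableSpace X] [StandardBorelSpace X]
    (μ : Measure X) [IsProbabilityMeasure μ]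
    (T : X → X) (hT : MeasurePreserving T μ μ) (hexact : Exact μ T)
    (E : Type) [NormedAddCommGroup E] [NormedSpace ℝ E] [CompleteSpace E]
    (tp : ContinuousMultilinearMap ℝ (fun _ : Fin 2 => Lp ℝ 2 μ) E)
    (hE : IsPTP μ (fun _ : Fin 2 => (2 : ℝ≥0∞)) E tp)
    (J : E →L[ℝ] Lp ℝ 2 (pm μ 2))
    (hJ : IsEmbed μ (fun _ : Fin 2 => (2 : ℝ≥0∞)) 2 tp J)
    (WK : (Fin 2 → ℕ) → E →L[ℝ] E)
    (hWK : ∀ k, IsTKoop μ (fun _ : Fin 2 => (2 : ℝ≥0∞)) tp (fun _ => T) k (WK k))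
    (WT : (Fin 2 → ℕ) → E →L[ℝ] E)
    (hWT : ∀ k, IsTTrans μ (fun _ : Fin 2 => (2 : ℝ≥0∞)) tp (fun _ => T) k (WT k))
    (f : E)
    (hfsym : Symm μ 2 (J f : (Fin 2 → X) → ℝ))
    (hfcanon : Canonical μ 2 (J f : (Fin 2 → X) → ℝ))
    (g : E)
    (hg : Tendsto (fun n : Fin 2 → ℕ =>
        ∑ k ∈ Fintype.piFinset (fun i => Finset.range (n i)), WT k f) atTop (𝓝 g)) :
    (∃! G : E × E × E × E,
      (f = G.1 + (WK ![1, 0] - 1) G.2.1 + (WK ![0, 1] - 1) G.2.2.1 +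
          ((WK ![1, 0] - 1) * (WK ![0, 1] - 1)) G.2.2.2) ∧
      ((pm μ 2)[(J G.1 : (Fin 2 → X) → ℝ) |
          MeasurableSpace.comap (fun x : Fin 2 → X => ![T (x 0), x 1]) inferInstance]
        =ᵐ[pm μ 2] 0) ∧
      ((pm μ 2)[(J G.1 : (Fin 2 → X) → ℝ) |
          MeasurableSpace.comap (fun x : Fin 2 → X => ![x 0, T (x 1)]) inferInstance]
        =ᵐ[pm μ 2] 0) ∧
      ((pm μ 2)[(J G.2.1 : (Fin 2 → X) → ℝ) |
          MeasurableSpace.comap (fun x : Fin 2 → X => ![x 0, T (x 1)]) inferInstance]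
        =ᵐ[pm μ 2] 0) ∧
      ((pm μ 2)[(J G.2.2.1 : (Fin 2 → X) → ℝ) |
          MeasurableSpace.comap (fun x : Fin 2 → X => ![T (x 0), x 1]) inferInstance]
        =ᵐ[pm μ 2] 0) ∧
      Canonical μ 2 (J G.1 : (Fin 2 → X) → ℝ) ∧
      Canonical μ 2 (J G.2.1 : (Fin 2 → X) → ℝ) ∧
      Canonical μ 2 (J G.2.2.1 : (Fin 2 → X) → ℝ) ∧
      Canonical μ 2 (J G.2.2.2 : (Fin 2 → X) → ℝ)) ∧
    (∀ G : E × E × E × E,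
      ((f = G.1 + (WK ![1, 0] - 1) G.2.1 + (WK ![0, 1] - 1) G.2.2.1 +
          ((WK ![1, 0] - 1) * (WK ![0, 1] - 1)) G.2.2.2) ∧
        ((pm μ 2)[(J G.1 : (Fin 2 → X) → ℝ) |
            MeasurableSpace.comap (fun x : Fin 2 → X => ![T (x 0), x 1]) inferInstance]
          =ᵐ[pm μ 2] 0) ∧
        ((pm μ 2)[(J G.1 : (Fin 2 → X) → ℝ) |
            MeasurableSpace.comap (fun x : Fin 2 → X => ![x 0, T (x 1)]) inferInstance]
          =ᵐ[pm μ 2] 0) ∧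
        ((pm μ 2)[(J G.2.1 : (Fin 2 → X) → ℝ) |
            MeasurableSpace.comap (fun x : Fin 2 → X => ![x 0, T (x 1)]) inferInstance]
          =ᵐ[pm μ 2] 0) ∧
        ((pm μ 2)[(J G.2.2.1 : (Fin 2 → X) → ℝ) |
            MeasurableSpace.comap (fun x : Fin 2 → X => ![T (x 0), x 1]) inferInstance]
          =ᵐ[pm μ 2] 0) ∧
        Canonical μ 2 (J G.1 : (Fin 2 → X) → ℝ) ∧
        Canonical μ 2 (J G.2.1 : (Fin 2 → X) → ℝ) ∧
        Canonical μ 2 (J G.2.2.1 : (Fin 2 → X) → ℝ) ∧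
        Canonical μ 2 (J G.2.2.2 : (Fin 2 → X) → ℝ)) →
      Symm μ 2 (J G.1 : (Fin 2 → X) → ℝ) ∧
      Symm μ 2 (J G.2.2.2 : (Fin 2 → X) → ℝ) ∧
      ((fun x : Fin 2 → X => (J G.2.1 : (Fin 2 → X) → ℝ) ![x 1, x 0])
        =ᵐ[pm μ 2] (J G.2.2.1 : (Fin 2 → X) → ℝ)) ∧
      ((fun x : Fin 2 → X => (J G.2.2.1 : (Fin 2 → X) → ℝ) ![x 1, x 0])
        =ᵐ[pm μ 2] (J G.2.1 : (Fin 2 → X) → ℝ))) := by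
  have e10 : (fun x : Fin 2 → X => ![T (x 0), x 1]) =
      fun z i => (Function.update (fun _ => id) 0 T : Fin 2 → X → X) i (z i) := by
    ext z i; fin_cases i <;> simp
  have e01 : (fun x : Fin 2 → X => ![x 0, T (x 1)]) =
      fun z i => (Function.update (fun _ => id) 1 T : Fin 2 → X → X) i (z i) := by
    ext z i; fin_cases i <;> simp
  set U : Fin 2 → (E →L[ℝ] E) := fun l => coordOp hE l (trans hT) with hU
  set V : Fin 2 → (E →L[ℝ] E) := fun l => coordOp hE l (koop hT) with hV
  set P : Fin 2 → (E →L[ℝ] E) := fun l => coordOp hE l (meanL μ) with hP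
  have hV0 : WK ![1, 0] = V 0 := by
    rw [WK_eq hE hT (hWK ![1, 0]), coordOp_two]; simp [hV, coordOp_one]
  have hV1 : WK ![0, 1] = V 1 := by
    rw [WK_eq hE hT (hWK ![0, 1]), coordOp_two]; simp [hV, coordOp_one]
  have hWTk : ∀ k, WT k = U 0 ^ k 0 * U 1 ^ k 1 := fun k => by
    rw [WT_eq hE hT (hWT k), coordOp_two]; simp only [hU, coordOp_pow]
  have c0 : ∀ u : E, _ ↔ U 0 u = 0 := fun u => cond_iff' hE hJ hT 0 u e10
  have c1 : ∀ u : E, _ ↔ U 1 u = 0 := fun u => cond_iff' hE hJ hT 1 u e01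
  have cP : ∀ u : E, Canonical μ 2 (J u : (Fin 2 → X) → ℝ) ↔ ∀ l, P l u = 0 :=
    fun u => canon_iff hE hJ u
  simp only [hV0, hV1, c0, c1, cP]
  simp only [hWTk] at hg
  rw [cP] at hfcanon
  -- operator identities
  have hUV : ∀ i h, U i (V i h) = h := fun i h => by
    rw [← mul_apply_eq_comp]; simp only [hU, hV, coordOp_mul, trans_koop, coordOp_one]; rfl
  have cUU' : U 0 * U 1 = U 1 * U 0 := coordOp_comm hE (by decide) _ _
  have cUU : ∀ h, U 0 (U 1 h) = U 1 (U 0 h) := fun h => DFunLike.congr_fun cUU' h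
  have cUV01 : ∀ h, U 0 (V 1 h) = V 1 (U 0 h) := fun h =>
    DFunLike.congr_fun (coordOp_comm hE (l := 0) (m := 1) (by decide) (trans hT) (koop hT)) h
  have cUV10 : ∀ h, U 1 (V 0 h) = V 0 (U 1 h) := fun h =>
    DFunLike.congr_fun (coordOp_comm hE (l := 1) (m := 0) (by decide) (trans hT) (koop hT)) h
  have cVV : ∀ h, V 0 (V 1 h) = V 1 (V 0 h) := fun h =>
    DFunLike.congr_fun (coordOp_comm hE (l := 0) (m := 1) (by decide) (koop hT) (koop hT)) h
  have nU : ∀ n : ℕ, ‖U 0 ^ n‖ ≤ 1 := fun n => by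
    simp only [hU, coordOp_pow]; exact coordOp_norm hE 0 _ (trans_pow_opNorm hT n)
  have lim : ∀ i h, P i h = 0 → Tendsto (fun n => (U i ^ n) h) atTop (𝓝 0) := fun i h hh => by
    rw [← hh]; exact coordOp_lim hE hT hexact i h
  have Pinv : ∀ (A : Lp ℝ 2 μ →L[ℝ] Lp ℝ 2 μ), meanL μ * A = meanL μ →
      ∀ i j h, P i h = 0 → P i (coordOp hE j A h) = 0 := fun A hA i j h hh => by
    rw [← mul_apply_eq_comp]
    by_cases hij : i = j
    · subst hij; simp only [hP, coordOp_mul, hA]; exact hh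
    · rw [hP, coordOp_comm hE hij, mul_apply_eq_comp]
      rw [show coordOp hE i (meanL μ) h = 0 from hh, map_zero]
  have PU : ∀ i j h, P i h = 0 → P i (U j h) = 0 := Pinv _ (meanL_trans hT)
  have PV : ∀ i j h, P i h = 0 → P i (V j h) = 0 := Pinv _ (meanL_koop hT)
  obtain ⟨hfg, hgP⟩ := core_exists cUU' nU lim PU hfcanon hg
  -- uniqueness
  have huniq : ∀ a b c d a' b' c' d' : E,
      f = a + (V 0 - 1) b + (V 1 - 1) c + ((V 0 - 1) * (V 1 - 1)) d →
      U 0 a = 0 → U 1 a = 0 → U 1 b = 0 → U 0 c = 0 →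
      (∀ l, P l b = 0) → (∀ l, P l c = 0) → (∀ l, P l d = 0) →
      f = a' + (V 0 - 1) b' + (V 1 - 1) c' + ((V 0 - 1) * (V 1 - 1)) d' →
      U 0 a' = 0 → U 1 a' = 0 → U 1 b' = 0 → U 0 c' = 0 →
      (∀ l, P l b' = 0) → (∀ l, P l c' = 0) → (∀ l, P l d' = 0) →
      a = a' ∧ b = b' ∧ c = c' ∧ d = d' := by
    intro a b c d a' b' c' d' h1 h2 h3 h4 h5 h6 h7 h8 k1 k2 k3 k4 k5 k6 k7 k8
    have key := core_uniq (U := U) (V := V) (P := P) (a := a - a') (b := b - b') (c := c - c')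
      (d := d - d') hUV cUU cUV10 lim PU (by
        have : f - f = 0 := sub_self f
        nth_rw 1 [h1] at this
        rw [k1] at this
        rw [← this]
        simp only [map_sub]
        abel)
      (by rw [map_sub, h2, k2, sub_zero]) (by rw [map_sub, h3, k3, sub_zero])
      (by rw [map_sub, h4, k4, sub_zero]) (by rw [map_sub, h5, k5, sub_zero])
      (fun i => by rw [map_sub, h6, k6, sub_zero]) (fun i => by rw [map_sub, h7, k7, sub_zero])
      (fun i => by rw [map_sub, h8, k8, sub_zero])
    simpa only [sub_eq_zero] using key
  constructor
  · refine existsUnique_of_exists_of_unique ⟨(g - V 0 (U 0 g) - V 1 (U 1 g) + V 0 (U 0 (V 1 (U 1 g))),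
      U 0 g - V 1 (U 1 (U 0 g)), U 1 g - V 0 (U 0 (U 1 g)), U 0 (U 1 g)), ?_⟩ ?_
    · refine ⟨?_, ?_, ?_, ?_, ?_, ?_, ?_, ?_, ?_⟩
      · dsimp only
        rw [hfg]
        simp only [mul_apply_eq_comp, sub_apply, one_apply_eq_self, map_sub, cUV01, cUU, cVV]
        abel
      · simp only [map_sub, map_add, hUV, cUV01, cUV10, cUU]; abel
      · simp only [map_sub, map_add, hUV, cUV01, cUV10, cUU]; abel
      · simp only [map_sub, map_add, hUV, cUV01, cUV10, cUU]; abel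
      · simp only [map_sub, map_add, hUV, cUV01, cUV10, cUU]; abel
      · intro l
        have h0 := hgP l
        simp only [map_sub, map_add]
        rw [h0, PV _ _ _ (PU _ _ _ h0), PV _ _ _ (PU _ _ _ h0),
          PV _ _ _ (PU _ _ _ (PV _ _ _ (PU _ _ _ h0)))]; simp
      · intro l
        have h0 := hgP l
        simp only [map_sub]
        rw [PU _ _ _ h0, PV _ _ _ (PU _ _ _ (PU _ _ _ h0))]; simp
      · intro l
        have h0 := hgP l
        simp only [map_sub]
        rw [PU _ _ _ h0, PV _ _ _ (PU _ _ _ (PU _ _ _ h0))]; simp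
      · intro l
        exact PU _ _ _ (PU _ _ _ (hgP l))
    · rintro ⟨a, b, c, d⟩ ⟨a', b', c', d'⟩ ⟨h1, h2, h3, h4, h5, h6, h7, h8, h9⟩
        ⟨k1, k2, k3, k4, k5, k6, k7, k8, k9⟩
      obtain ⟨rfl, rfl, rfl, rfl⟩ := huniq a b c d a' b' c' d' h1 h2 h3 h4 h5 h7 h8 h9
        k1 k2 k3 k4 k5 k7 k8 k9
      rfl
  · rintro ⟨a, b, c, d⟩ ⟨h1, h2, h3, h4, h5, h6, h7, h8, h9⟩
    dsimp only at h1 h2 h3 h4 h5 h6 h7 h8 h9 ⊢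
    set F := flip hE with hF
    have hswap : ∀ u : E, (fun z : Fin 2 → X => (J u : (Fin 2 → X) → ℝ) ![z 1, z 0])
        =ᵐ[pm μ 2] J (F u) := flip_coe hE hJ
    have hFf : F f = f := by
      refine J_inj' hE hJ (Lp.ext ((hswap f).symm.trans ?_))
      filter_upwards [hfsym (Equiv.swap 0 1)] with z hz
      rw [← hz]
      congr 1
      ext i; fin_cases i <;> simp
    have FU0 : ∀ h, F (U 0 h) = U 1 (F h) := fun h => flip_coordOp hE 0 _ h
    have FU1 : ∀ h, F (U 1 h) = U 0 (F h) := fun h => flip_coordOp hE 1 _ h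
    have FV0 : ∀ h, F (V 0 h) = V 1 (F h) := fun h => flip_coordOp hE 0 _ h
    have FV1 : ∀ h, F (V 1 h) = V 0 (F h) := fun h => flip_coordOp hE 1 _ h
    have FP : ∀ h, (∀ l, P l h = 0) → ∀ l, P l (F h) = 0 := fun h hh l => by
      have := flip_coordOp hE (Equiv.swap 0 1 l) (meanL μ) h
      rw [Equiv.swap_apply_self] at this
      refine this.symm.trans ?_
      rw [show coordOp hE (Equiv.swap 0 1 l) (meanL μ) h = 0 from hh _, map_zero]
    obtain ⟨q1, q2, q3, q4⟩ := huniq a b c d (F a) (F c) (F b) (F d) h1 h2 h3 h4 h5 h7 h8 h9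
      (by
        rw [← hFf, h1]
        simp only [mul_apply_eq_comp, sub_apply, one_apply_eq_self, map_sub, map_add, FV0, FV1,
          cVV]
        abel)
      (by rw [← FU1, h3, map_zero]) (by rw [← FU0, h2, map_zero])
      (by rw [← FU0, h5, map_zero]) (by rw [← FU1, h4, map_zero])
      (FP _ h8) (FP _ h7) (FP _ h9)
    have hsym : ∀ u : E, u = F u → Symm μ 2 (J u : (Fin 2 → X) → ℝ) := by
      intro u hu σ
      have hs := hswap u
      rw [← hu] at hs
      have hσ : σ = 1 ∨ σ = Equiv.swap 0 1 := by
        revert σ; decide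
      rcases hσ with rfl | rfl
      · exact Eventually.of_forall fun z => rfl
      · filter_upwards [hs] with z hz
        rw [← hz]
        congr 1
        ext i; fin_cases i <;> simp
    refine ⟨hsym a q1, hsym d q4, ?_, ?_⟩
    · rw [q3]; exact hswap b
    · rw [q2]; exact hswap c

end VonMises
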